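/- Two-sided concentration of the empirical flip frequency in the vote protocol: let s ≥ 1 and n ≥ 3 be integers and let p be a real number with 1/(2·e²·n) ≤ p ≤ 1. If X is a binomial random variable with s trials and success probability p, then ℙ(|X − s·p| ≥ s/(2·e²·n)) ≤ Real.exp(−s/(8·e⁴·n²·p)) + Real.exp(−s/(16·e⁴·n²·p)); in particular this probability is exponentially small in s. -/

import Mathlib

open MeasureTheory

noncomputable def binW (s : ℕ) (p : ℝ) (k : ℕ) : ℝ := p ^ k * (1 - p) ^ (s - k) * (s.choose k : ℝ)

lemma binW_nonneg (s : ℕ) (p : ℝ) (h0 : 0 ≤ p) (h1 : p ≤ 1) (k : ℕ) : 0 ≤ binW s p k := by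
  have : 0 ≤ 1 - p := by linarith
  unfold binW; positivity

lemma binW_mgf (s : ℕ) (p c : ℝ) (h0 : 0 ≤ p) (h1 : p ≤ 1) :
    ∑ k : Fin (s + 1), binW s p k * Real.exp (c * (k : ℕ)) ≤ Real.exp (s * (p * (Real.exp c - 1))) := by
  have h : ∑ k : Fin (s + 1), binW s p k * Real.exp (c * (k : ℕ)) = (p * Real.exp c + (1 - p)) ^ s := by
    rw [add_pow, Finset.sum_range]
    refine Finset.sum_congr rfl fun k _ => ?_
    unfold binW
    rw [mul_comm c, Real.exp_nat_mul, mul_pow]; ring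
  rw [h, Real.exp_nat_mul]
  have := Real.add_one_le_exp (p * (Real.exp c - 1))
  have h2 : 0 ≤ p * Real.exp c := by positivity
  exact pow_le_pow_left₀ (by linarith) (by linarith) s

lemma exp_up (x : ℝ) (h0 : 0 ≤ x) (h1 : x ≤ 1) : Real.exp x - 1 - x ≤ x ^ 2 := by
  have := Real.abs_exp_sub_one_sub_id_le (x := x) (by rw [abs_of_nonneg h0]; exact h1)
  exact (abs_le.1 this).2

lemma exp_down (x : ℝ) (h0 : 0 ≤ x) : Real.exp (-x) - 1 + x ≤ x ^ 2 / 2 := by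
  have h := Real.quadratic_le_exp_of_nonneg h0
  have h3 : Real.exp x * Real.exp (-x) = 1 := by rw [← Real.exp_add]; simp
  have h4 := Real.exp_pos (-x)
  have h5 : 0 < 1 - x + x ^ 2 / 2 := by nlinarith [sq_nonneg (x - 1)]
  have h6 : Real.exp (-x) * (1 + x + x ^ 2 / 2) ≤ 1 := by nlinarith
  have h7 : 0 < 1 + x + x ^ 2 / 2 := by positivity
  have h8 : Real.exp (-x) * (1 + x + x ^ 2 / 2) ≤ (1 - x + x ^ 2 / 2) * (1 + x + x ^ 2 / 2) := by
    nlinarith [sq_nonneg (x ^ 2)]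
  have := le_of_mul_le_mul_right h8 h7
  linarith

/-- Weighted sum of a shifted exponential. -/
lemma tail_mgf (s : ℕ) (p c b : ℝ) (h0 : 0 ≤ p) (h1 : p ≤ 1) :
    ∑ k : Fin (s + 1), binW s p k * Real.exp (c * (k : ℕ) + b)
      ≤ Real.exp (s * (p * (Real.exp c - 1)) + b) := by
  simp_rw [Real.exp_add, ← mul_assoc]
  rw [← Finset.sum_mul]
  have h := binW_mgf s p c h0 h1
  simp only [← mul_assoc] at h
  exact mul_le_mul_of_nonneg_right h (Real.exp_pos _).le

/-- Real-valued two-sided Chernoff bound. -/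
lemma chernoff (s : ℕ) (p a : ℝ) (ha : 0 < a) (hap : a ≤ p) (h1 : p ≤ 1)
    (S : Set (Fin (s + 1))) (hS : ∀ k ∈ S, |((k : ℕ) : ℝ) - s * p| ≥ s * a) :
    ∑ k : Fin (s + 1), S.indicator (fun k => binW s p (k : ℕ)) k
      ≤ Real.exp (-(s * a ^ 2 / (2 * p))) + Real.exp (-(s * a ^ 2 / (4 * p))) := by
  have hp : 0 < p := by linarith
  set d := a / p with hd
  have hd0 : 0 < d := by positivity
  have hd1 : d ≤ 1 := (div_le_one hp).2 hap
  have had : a = d * p := by rw [hd]; field_simp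
  have hs : (0 : ℝ) ≤ s := by positivity
  have e1 : s * a ^ 2 / (2 * p) = s * p * d ^ 2 / 2 := by rw [had]; field_simp
  have e2 : s * a ^ 2 / (4 * p) = s * p * d ^ 2 / 4 := by rw [had]; field_simp
  have hsp : 0 ≤ s * p := by positivity
  have hlow := tail_mgf s p (-d) (d * (s * p) - d * (s * a)) hp.le h1
  have hup := tail_mgf s p (d / 2) (-(d / 2 * (s * p)) - d / 2 * (s * a)) hp.le h1
  have hl2 : s * (p * (Real.exp (-d) - 1)) + (d * (s * p) - d * (s * a))
      ≤ -(s * a ^ 2 / (2 * p)) := by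
    rw [e1, had]
    nlinarith [mul_le_mul_of_nonneg_left (exp_down d hd0.le) hsp]
  have hu2 : s * (p * (Real.exp (d / 2) - 1)) + (-(d / 2 * (s * p)) - d / 2 * (s * a))
      ≤ -(s * a ^ 2 / (4 * p)) := by
    rw [e2, had]
    nlinarith [mul_le_mul_of_nonneg_left (exp_up (d / 2) (by linarith) (by linarith)) hsp]
  refine le_trans ?_ (add_le_add (hlow.trans (Real.exp_le_exp.2 hl2))
    (hup.trans (Real.exp_le_exp.2 hu2)))
  rw [← Finset.sum_add_distrib]
  refine Finset.sum_le_sum fun k _ => ?_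
  have hw := binW_nonneg s p hp.le h1 k
  rw [← mul_add]
  by_cases hk : k ∈ S
  · rw [Set.indicator_of_mem hk]
    refine le_mul_of_one_le_right hw ?_
    have p1 := Real.exp_pos (-d * ((k : ℕ) : ℝ) + (d * (s * p) - d * (s * a)))
    have p2 := Real.exp_pos (d / 2 * ((k : ℕ) : ℝ) + (-(d / 2 * (s * p)) - d / 2 * (s * a)))
    rcases le_abs.1 (hS k hk) with h | h
    · have : 1 ≤ Real.exp (d / 2 * ((k : ℕ) : ℝ) + (-(d / 2 * (s * p)) - d / 2 * (s * a))) := by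
        apply Real.one_le_exp
        nlinarith
      linarith
    · have : 1 ≤ Real.exp (-d * ((k : ℕ) : ℝ) + (d * (s * p) - d * (s * a))) := by
        apply Real.one_le_exp
        nlinarith
      linarith
  · rw [Set.indicator_of_notMem hk]
    positivity



/-- **Two-sided concentration of the empirical flip frequency in the vote
protocol.** If `X` is binomial with `s ≥ 1` trials and success probability
`p ≥ 1/(2e²n)` (with `n ≥ 3`), then
`ℙ(|X − s·p| ≥ s/(2e²n)) ≤ exp(−s/(8e⁴n²p)) + exp(−s/(16e⁴n²p))`. -/
theorem vote_tally_concentration (s n : ℕ) (hs : 1 ≤ s) (hn : 3 ≤ n)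
    (p : ℝ) (hp1 : p ≤ 1)
    (hp0 : 1 / (2 * Real.exp 1 ^ 2 * (n : ℝ)) ≤ p) :
    (PMF.binomial (Real.toNNReal p) (Real.toNNReal_le_one.mpr hp1) s).toMeasure
        {k : Fin (s + 1) |
          |(k : ℝ) - (s : ℝ) * p| ≥ (s : ℝ) / (2 * Real.exp 1 ^ 2 * (n : ℝ))}
      ≤ ENNReal.ofReal
            (Real.exp (-(s : ℝ) / (8 * Real.exp 1 ^ 4 * (n : ℝ) ^ 2 * p))) +
          ENNReal.ofReal
            (Real.exp (-(s : ℝ) / (16 * Real.exp 1 ^ 4 * (n : ℝ) ^ 2 * p))) := by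
  have hn' : (0 : ℝ) < n := by exact_mod_cast (by omega : 0 < n)
  have he := Real.exp_pos 1
  have ha : 0 < 1 / (2 * Real.exp 1 ^ 2 * (n : ℝ)) := by positivity
  have hp : 0 < p := by linarith
  have hS := chernoff s p _ ha hp0 hp1
    {k : Fin (s + 1) |
          |(k : ℝ) - (s : ℝ) * p| ≥ (s : ℝ) / (2 * Real.exp 1 ^ 2 * (n : ℝ))}
    (fun k hk => by rw [mul_one_div]; exact hk)
  have e1 : -((s : ℝ) * (1 / (2 * Real.exp 1 ^ 2 * (n : ℝ))) ^ 2 / (2 * p))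
      = -(s : ℝ) / (8 * Real.exp 1 ^ 4 * (n : ℝ) ^ 2 * p) := by
    field_simp; norm_num
  have e2 : -((s : ℝ) * (1 / (2 * Real.exp 1 ^ 2 * (n : ℝ))) ^ 2 / (4 * p))
      = -(s : ℝ) / (16 * Real.exp 1 ^ 4 * (n : ℝ) ^ 2 * p) := by
    field_simp; norm_num
  rw [e1, e2] at hS
  rw [← ENNReal.ofReal_add (Real.exp_pos _).le (Real.exp_pos _).le]
  refine le_trans (le_of_eq ?_) (ENNReal.ofReal_le_ofReal hS)
  rw [PMF.toMeasure_apply_fintype, ENNReal.ofReal_sum_of_nonneg]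
  · refine Finset.sum_congr rfl fun k _ => ?_
    simp only [Set.indicator_apply]
    split_ifs
    · have h1p : (0 : ℝ) ≤ 1 - p := by linarith
      rw [PMF.binomial_apply]
      unfold binW
      rw [ENNReal.ofReal_mul (by positivity), ENNReal.ofReal_mul (by positivity),
        ENNReal.ofReal_pow hp.le, ENNReal.ofReal_pow h1p, ENNReal.ofReal_sub _ hp.le]
      simp [ENNReal.ofReal]
    · simp
  · intro k _
    exact Set.indicator_apply_nonneg (fun _ => binW_nonneg s p hp.le hp1 k)
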